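/- arXiv:2307.12898 — 5 statements merged into one kernel-verified Lean document; each statement's English description precedes it below -/
import Mathlib

section
/- Let V be a type, A : V → V → ℕ → Prop a directed temporal graph, Δ ∈ ℕ, k ≥ 1, and fix vertices v₀, …, v_k and times t₁, …, t_k with t_i ≥ 1 for every i. Then (v₀, …, v_k; t₁, …, t_k) is a Δ-restless temporal walk in A if and only if the reversed data (v_k, …, v₀; t_k, …, t₁) is a δ-time-conscious temporal walk from v_k to v₀ in the reverse graph Aʳ, where δ v t = min(t − 1, Δ). The same equivalence holds with 'walk' replaced by 'path'. -/
/-- A temporal walk of length `k` in the directed temporal graph `A`: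
vertices `v 0, …, v k`; for each `i ∈ {1,…,k}`, edge `i` goes from `v (i-1)`
to `v i` and is taken at time `t i ≥ 1`. -/
def TWalk {V : Type*} (A : V → V → ℕ → Prop) (k : ℕ) (v : ℕ → V) (t : ℕ → ℕ) : Prop :=
  ∀ i, 1 ≤ i → i ≤ k → 1 ≤ t i ∧ A (v (i - 1)) (v i) (t i)

/-- A temporal path: a temporal walk whose vertices `v 0, …, v k` are pairwise distinct. -/
def TPath {V : Type*} (A : V → V → ℕ → Prop) (k : ℕ) (v : ℕ → V) (t : ℕ → ℕ) : Prop :=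
  TWalk A k v t ∧ ∀ i j, i ≤ k → j ≤ k → v i = v j → i = j

/-- Time-respecting: the times `t 1 ≤ t 2 ≤ … ≤ t k` are nondecreasing. -/
def TimeRespecting (k : ℕ) (t : ℕ → ℕ) : Prop :=
  ∀ i, 1 ≤ i → i < k → t i ≤ t (i + 1)

/-- `Δ`-restless: time-respecting and moreover `t (i+1) ≤ t i + Δ` for `i ∈ {1,…,k-1}`. -/
def Restless (Δ k : ℕ) (t : ℕ → ℕ) : Prop :=
  TimeRespecting k t ∧ ∀ i, 1 ≤ i → i < k → t (i + 1) ≤ t i + Δ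

/-- `δ`-time-conscious: for every `i ∈ {1,…,k-1}`, `t i ≥ t (i+1)` and
`t (i+1) ≥ t i − δ u (t i)` where `u = v (i-1)` is the tail of edge `i`. -/
def TimeConscious {V : Type*} (δ : V → ℕ → ℕ) (k : ℕ) (v : ℕ → V) (t : ℕ → ℕ) : Prop :=
  ∀ i, 1 ≤ i → i < k → t (i + 1) ≤ t i ∧ t i - δ (v (i - 1)) (t i) ≤ t (i + 1)

/-- The reverse of a directed temporal graph. -/
def revGraph {V : Type*} (A : V → V → ℕ → Prop) : V → V → ℕ → Prop := fun u v t => A v u t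

theorem tWalk_revGraph_iff {V : Type*} (A : V → V → ℕ → Prop) (k : ℕ) (v : ℕ → V) (t : ℕ → ℕ) :
    TWalk (revGraph A) k (fun i => v (k - i)) (fun i => t (k + 1 - i)) ↔ TWalk A k v t := by
  constructor <;> intro h i h1 hk
  · have hi := h (k + 1 - i) (by omega) (by omega)
    simp only [revGraph] at hi
    rwa [show k + 1 - (k + 1 - i) = i by omega, show k - (k + 1 - i) = i - 1 by omega,
      show k - (k + 1 - i - 1) = i by omega] at hi
  · have hi := h (k + 1 - i) (by omega) (by omega)
    simp only [revGraph]
    rwa [show k + 1 - i - 1 = k - i by omega,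
      show v (k + 1 - i) = v (k - (i - 1)) by congr 1; omega] at hi

theorem tPath_revGraph_iff {V : Type*} (A : V → V → ℕ → Prop) (k : ℕ) (v : ℕ → V) (t : ℕ → ℕ) :
    TPath (revGraph A) k (fun i => v (k - i)) (fun i => t (k + 1 - i)) ↔ TPath A k v t := by
  refine and_congr (tWalk_revGraph_iff A k v t) ?_
  constructor <;> intro h i j hi hj hij
  · have := h (k - i) (k - j) (by omega) (by omega)
      (by simpa only [Nat.sub_sub_self hi, Nat.sub_sub_self hj] using hij)
    omega
  · have := h (k - i) (k - j) (by omega) (by omega) hij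
    omega

theorem timeConscious_reverse_iff_restless {V : Type*} (Δ k : ℕ) (v : ℕ → V) (t : ℕ → ℕ)
    (ht : ∀ i, 1 ≤ i → i ≤ k → 1 ≤ t i) :
    TimeConscious (fun _ s => min (s - 1) Δ) k v (fun i => t (k + 1 - i)) ↔ Restless Δ k t := by
  constructor
  · intro h
    have key : ∀ i, 1 ≤ i → i < k → t i ≤ t (i + 1) ∧ t (i + 1) ≤ t i + Δ := by
      intro i h1 hk
      have hi := h (k - i) (by omega) (by omega)
      simp only [show k + 1 - (k - i + 1) = i by omega,
        show k + 1 - (k - i) = i + 1 by omega] at hi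
      omega
    exact ⟨fun i h1 hk => (key i h1 hk).1, fun i h1 hk => (key i h1 hk).2⟩
  · rintro ⟨hle, hΔ⟩ i h1 hk
    have h₁ := hle (k - i) (by omega) (by omega)
    have h₂ := hΔ (k - i) (by omega) (by omega)
    have h₃ := ht (k - i) (by omega) (by omega)
    simp only [show k + 1 - (i + 1) = k - i by omega, show k + 1 - i = k - i + 1 by omega]
    omega

/-- `(v₀,…,v_k; t₁,…,t_k)` is a `Δ`-restless temporal walk in `A`
iff the reversed data `(v_k,…,v₀; t_k,…,t₁)` is a `δ`-time-conscious temporal walk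
in the reverse graph, for the horizon `δ v t = min (t − 1) Δ`.
The same holds with walks replaced by paths. -/
theorem restless_iff_time_conscious_of_reverse
    {V : Type*} (A : V → V → ℕ → Prop) (Δ : ℕ) (k : ℕ) (hk : 1 ≤ k)
    (v : ℕ → V) (t : ℕ → ℕ) (ht : ∀ i, 1 ≤ i → i ≤ k → 1 ≤ t i) :
    ((TWalk A k v t ∧ Restless Δ k t) ↔
      (TWalk (revGraph A) k (fun i => v (k - i)) (fun i => t (k + 1 - i)) ∧
        TimeConscious (fun _ s => min (s - 1) Δ) k
          (fun i => v (k - i)) (fun i => t (k + 1 - i)))) ∧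
    ((TPath A k v t ∧ Restless Δ k t) ↔
      (TPath (revGraph A) k (fun i => v (k - i)) (fun i => t (k + 1 - i)) ∧
        TimeConscious (fun _ s => min (s - 1) Δ) k
          (fun i => v (k - i)) (fun i => t (k + 1 - i)))) := by
  rw [tWalk_revGraph_iff, tPath_revGraph_iff, timeConscious_reverse_iff_restless Δ k _ t ht]
  exact ⟨Iff.rfl, Iff.rfl⟩
end

section
/- Let V be a type, A : V → V → ℕ → Prop a directed temporal graph, Δ ∈ ℕ, L ≥ 1, k ≥ 1, and fix vertices v₀, …, v_k and times t₁, …, t_k with 1 ≤ t_i ≤ L for every i. Define the time-flipped temporal graph A' by A' u v s := A u v (L + 1 − s) for 1 ≤ s ≤ L. Then (v₀, …, v_k; t₁, …, t_k) is a δ-time-conscious temporal walk in A for the horizon δ v t = min(t − 1, Δ) if and only if (v₀, …, v_k; L+1−t₁, …, L+1−t_k) is a Δ-restless temporal walk in A'. -/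
/-- with all times in `{1,…,L}` and the time-flipped graph
`A' u v s := A u v (L + 1 − s)`, the walk `(v₀,…,v_k; t₁,…,t_k)` is a
`δ`-time-conscious temporal walk in `A` for the horizon `δ v t = min (t − 1) Δ`
iff `(v₀,…,v_k; L+1−t₁,…,L+1−t_k)` is a `Δ`-restless temporal walk in `A'`. -/
theorem time_conscious_iff_restless_of_flip
    {V : Type*} (A : V → V → ℕ → Prop) (Δ L k : ℕ) (hL : 1 ≤ L) (hk : 1 ≤ k)
    (v : ℕ → V) (t : ℕ → ℕ) (ht : ∀ i, 1 ≤ i → i ≤ k → 1 ≤ t i ∧ t i ≤ L) :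
    (TWalk A k v t ∧ TimeConscious (fun _ s => min (s - 1) Δ) k v t) ↔
      (TWalk (fun u w s => A u w (L + 1 - s)) k v (fun i => L + 1 - t i) ∧
        Restless Δ k (fun i => L + 1 - t i)) := by
  have flip_flip : ∀ i, 1 ≤ i → i ≤ k → L + 1 - (L + 1 - t i) = t i := by
    intro i h1 hi
    have := ht i h1 hi
    omega
  refine and_congr ?_ ?_
  · refine forall_congr' fun i => forall_congr' fun h1 => forall_congr' fun hi => ?_
    have := ht i h1 hi
    simp only [flip_flip i h1 hi]
    exact and_congr_left' (by omega)
  · simp only [TimeConscious, Restless, TimeRespecting, ← forall_and]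
    refine forall_congr' fun i => forall_congr' fun h1 => forall_congr' fun hi => ?_
    have := ht i h1 hi.le
    have := ht (i + 1) (by omega) hi
    omega
end

section
/- Let V be a type and A : V → V → ℕ → Prop a directed temporal graph. Define a static directed graph D on triples (u, v, t) ∈ V × V × ℕ with A u v t, putting an edge from (v, z, t₂) to (u, v, t₁) whenever A u v t₁, A v z t₂, and t₂ ≤ t₁. Then for any u, v, x, y ∈ V and times t, s ≥ 1 with A u v t and A x y s, the following are equivalent: (a) there exists a temporal walk in A with nonincreasing times whose first edge is (u, v) taken at time t and whose last edge is (x, y) taken at time s; (b) there exists a directed walk in D from (x, y, s) to (u, v, t). -/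
/-- The static expansion digraph on triples `(u, v, t)` with `A u v t`: there is a
directed edge from `(v, z, t₂)` to `(u, v, t₁)` whenever `A u v t₁`, `A v z t₂`
and `t₂ ≤ t₁`. -/
def StaticExpansionEdge {V : Type*} (A : V → V → ℕ → Prop) :
    V × V × ℕ → V × V × ℕ → Prop :=
  fun e f => A e.1 e.2.1 e.2.2 ∧ A f.1 f.2.1 f.2.2 ∧ e.1 = f.2.1 ∧ e.2.2 ≤ f.2.2

/-- Prepending an available edge to a temporal walk. -/
theorem TWalk.cons {V : Type*} {A : V → V → ℕ → Prop} {k : ℕ} {vs : ℕ → V} {ts : ℕ → ℕ}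
    (h : TWalk A k vs ts) {u : V} {t : ℕ} (ht : 1 ≤ t) (hA : A u (vs 0) t) :
    TWalk A (k + 1) (fun i => if i = 0 then u else vs (i - 1))
      (fun i => if i = 1 then t else ts (i - 1)) := by
  intro i hi hik
  obtain rfl | hi' := hi.eq_or_lt
  · simpa using ⟨ht, hA⟩
  · have := h (i - 1) (by omega) (by omega)
    have h0 : i ≠ 0 := by omega
    have h1 : i ≠ 1 := by omega
    have h2 : i - 1 ≠ 0 := by omega
    simpa [h0, h1, h2] using this

/-- Every edge of a temporal walk with nonincreasing times reaches the first edge in the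
static expansion. -/
theorem TWalk.reflTransGen_staticExpansionEdge {V : Type*} {A : V → V → ℕ → Prop} {k : ℕ}
    {vs : ℕ → V} {ts : ℕ → ℕ} (h : TWalk A k vs ts)
    (hmono : ∀ i, 1 ≤ i → i < k → ts (i + 1) ≤ ts i) {j : ℕ} (hj : 1 ≤ j) (hjk : j ≤ k) :
    Relation.ReflTransGen (StaticExpansionEdge A)
      (vs (j - 1), vs j, ts j) (vs 0, vs 1, ts 1) := by
  induction j, hj using Nat.le_induction with
  | base => exact .refl
  | succ n hn ih =>
    exact .head ⟨(h (n + 1) (by omega) hjk).2, (h n hn (by omega)).2, rfl, hmono n hn hjk⟩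
      (ih (by omega))

/-- A directed walk in the static expansion starting at a triple with positive time comes from
a temporal walk with nonincreasing times, traversed backwards. -/
theorem exists_tWalk_of_reflTransGen_staticExpansionEdge {V : Type*} {A : V → V → ℕ → Prop}
    {x y : V} {s : ℕ} (hs : 1 ≤ s) (hxy : A x y s) {e : V × V × ℕ}
    (h : Relation.ReflTransGen (StaticExpansionEdge A) (x, y, s) e) :
    ∃ k, 1 ≤ k ∧ ∃ (vs : ℕ → V) (ts : ℕ → ℕ), TWalk A k vs ts ∧
      (∀ i, 1 ≤ i → i < k → ts (i + 1) ≤ ts i) ∧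
      vs 0 = e.1 ∧ vs 1 = e.2.1 ∧ ts 1 = e.2.2 ∧ vs (k - 1) = x ∧ vs k = y ∧ ts k = s := by
  induction h with
  | refl =>
    refine ⟨1, le_rfl, fun i => if i = 0 then x else y, fun _ => s, ?_, by simp, by simp⟩
    intro i hi hi'
    obtain rfl : i = 1 := by omega
    simpa using ⟨hs, hxy⟩
  | @tail b c _ hbc ih =>
    obtain ⟨k, hk, vs, ts, hw, hmono, h0, h1, ht, hx, hy, hts⟩ := ih
    obtain ⟨-, hc, hv, hle⟩ := hbc
    have hpos := (hw 1 le_rfl hk).1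
    refine ⟨k + 1, by omega, _, _,
      hw.cons (u := c.1) (t := c.2.2) (by omega) (by rwa [h0, hv]), ?_, ?_⟩
    · intro i hi hik
      obtain rfl | hi' := hi.eq_or_lt
      · simpa [ht] using hle
      · have := hmono (i - 1) (by omega) (by omega)
        rw [Nat.sub_add_cancel hi] at this
        have h2 : i ≠ 0 := by omega
        have h3 : i ≠ 1 := by omega
        simpa [h2, h3] using this
    · have hk' : k ≠ 0 := by omega
      simp [hk', h0, hv, hx, hy, hts]

/-- there is a temporal walk in `A` with nonincreasing times whose
first edge is `(u, v)` at time `t` and whose last edge is `(x, y)` at time `s`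
iff there is a directed walk in the static expansion from `(x, y, s)` to `(u, v, t)`. -/
theorem nonincreasing_temporal_walk_iff_static_expansion_walk
    {V : Type*} (A : V → V → ℕ → Prop) (u v x y : V) (t s : ℕ)
    (ht : 1 ≤ t) (hs : 1 ≤ s) (huv : A u v t) (hxy : A x y s) :
    (∃ k, 1 ≤ k ∧ ∃ (vs : ℕ → V) (ts : ℕ → ℕ), TWalk A k vs ts ∧
        (∀ i, 1 ≤ i → i < k → ts (i + 1) ≤ ts i) ∧
        vs 0 = u ∧ vs 1 = v ∧ ts 1 = t ∧ vs (k - 1) = x ∧ vs k = y ∧ ts k = s) ↔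
      Relation.ReflTransGen (StaticExpansionEdge A) (x, y, s) (u, v, t) := by
  constructor
  · rintro ⟨k, hk, vs, ts, hw, hmono, rfl, rfl, rfl, rfl, rfl, rfl⟩
    exact hw.reflTransGen_staticExpansionEdge hmono hk le_rfl
  · exact exists_tWalk_of_reflTransGen_staticExpansionEdge hs hxy
end

section
/- There exist a finite type V, a directed temporal graph A : V → V → ℕ → Prop, and vertices s ≠ z in V such that there is a 1-restless temporal walk from s to z in A, but there is no 1-restless temporal path from s to z in A. -/
/-- The directed temporal graph on `Fin 4` whose edges are `(0, 1)` at time `1`, `(1, 2)` at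
time `2`, `(2, 1)` at time `3` and `(1, 3)` at time `4`. -/
def detourGraph (u v : Fin 4) (t : ℕ) : Prop :=
  (u = 0 ∧ v = 1 ∧ t = 1) ∨ (u = 1 ∧ v = 2 ∧ t = 2) ∨
    (u = 2 ∧ v = 1 ∧ t = 3) ∨ (u = 1 ∧ v = 3 ∧ t = 4)

/-- The vertices `0, 1, 2, 1, 3` of the walk in `detourGraph` that takes the detour through `2`. -/
def detourVertex : ℕ → Fin 4
  | 0 => 0
  | 1 => 1
  | 2 => 2
  | 3 => 1
  | _ => 3

theorem tWalk_detourVertex : TWalk detourGraph 4 detourVertex id := by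
  intro i h1 h4
  interval_cases i <;> simp [detourGraph, detourVertex]

theorem restless_one_id (k : ℕ) : Restless 1 k id :=
  ⟨fun i _ _ => Nat.le_succ i, fun _ _ _ => le_rfl⟩

theorem detourGraph_from_zero {v : Fin 4} {t : ℕ} (h : detourGraph 0 v t) : v = 1 ∧ t = 1 := by
  simpa [detourGraph] using h

theorem detourGraph_to_three {u : Fin 4} {t : ℕ} (h : detourGraph u 3 t) : u = 1 ∧ t = 4 := by
  simpa [detourGraph] using h

theorem not_restless_of_tPath_detourGraph {k : ℕ} (hk : 1 ≤ k) {v : ℕ → Fin 4} {t : ℕ → ℕ}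
    (hp : TPath detourGraph k v t) (h0 : v 0 = 0) (h3 : v k = 3) : ¬ Restless 1 k t := by
  intro hr
  have hfirst := (hp.1 1 le_rfl hk).2
  rw [Nat.sub_self, h0] at hfirst
  obtain ⟨hv1, ht1⟩ := detourGraph_from_zero hfirst
  have hlast := (hp.1 k hk le_rfl).2
  rw [h3] at hlast
  obtain ⟨hvk, htk⟩ := detourGraph_to_three hlast
  have hk2 : k - 1 = 1 := hp.2 _ _ (Nat.sub_le k 1) hk (hvk.trans hv1.symm)
  obtain rfl : k = 2 := by omega
  have := hr.2 1 le_rfl one_lt_two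
  norm_num at this
  omega

/-- there are a finite directed temporal graph and distinct vertices
`s ≠ z` such that a `1`-restless temporal walk from `s` to `z` exists, but no
`1`-restless temporal path from `s` to `z` exists. -/
theorem restless_walk_not_path :
    ∃ (V : Type) (_ : Fintype V) (A : V → V → ℕ → Prop) (s z : V),
      s ≠ z ∧
      (∃ k, 1 ≤ k ∧ ∃ (vs : ℕ → V) (ts : ℕ → ℕ),
        TWalk A k vs ts ∧ Restless 1 k ts ∧ vs 0 = s ∧ vs k = z) ∧
      ¬(∃ k, 1 ≤ k ∧ ∃ (vs : ℕ → V) (ts : ℕ → ℕ),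
        TPath A k vs ts ∧ Restless 1 k ts ∧ vs 0 = s ∧ vs k = z) := by
  refine ⟨Fin 4, inferInstance, detourGraph, 0, 3, by decide,
    ⟨4, by norm_num, detourVertex, id, tWalk_detourVertex, restless_one_id 4, rfl, rfl⟩, ?_⟩
  rintro ⟨k, hk, vs, ts, hp, hr, h0, h3⟩
  exact not_restless_of_tPath_detourGraph hk hp h0 h3 hr
end

section
/- Let V' be a type, A' : V' → V' → ℕ → Prop a directed temporal graph with all available times in {1, …, L'}, x ≠ y in V', and Δ ∈ ℕ. Let V = V' ⊕ {▽} and define A on V by: A u v t := A' v u t for u, v ∈ V' (the reverse of A'); A x ▽ t for every t ∈ {1, …, L' + 1}; and no other edges incident to ▽. Let δ v t = min(t − 1, Δ) for every v ∈ V. Then there exists a Δ-restless temporal path from x to y in A' if and only if there exists a δ-time-conscious temporal path from y to ▽ in A. -/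
/-- The temporal graph of the reduction (Theorem 3): on `V' ⊕ Unit`, where
`Sum.inr ()` plays the role of the sink `▽`, the edges between original vertices
are those of the reverse of `A'`, the vertex `x` has an edge to `▽` available at
every time in `{1, …, L' + 1}`, and there are no other edges incident to `▽`. -/
def ReductionGraph {V' : Type*} (A' : V' → V' → ℕ → Prop) (x : V') (L' : ℕ) :
    V' ⊕ Unit → V' ⊕ Unit → ℕ → Prop
  | Sum.inl u, Sum.inl w, t => A' w u t
  | Sum.inl u, Sum.inr _, t => u = x ∧ 1 ≤ t ∧ t ≤ L' + 1
  | Sum.inr _, _, _ => False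

/-- for a temporal graph `A'` with all available times in
`{1,…,L'}`, `x ≠ y` and `Δ ∈ ℕ`, there is a `Δ`-restless temporal path from `x`
to `y` in `A'` iff there is a `δ`-time-conscious temporal path from `y` to `▽`
in the reduction graph, where `δ v t = min (t − 1) Δ`. -/
theorem restless_path_iff_time_conscious_path_reduction
    {V' : Type*} (A' : V' → V' → ℕ → Prop) (L' : ℕ)
    (hA' : ∀ u w t, A' u w t → 1 ≤ t ∧ t ≤ L')
    (x y : V') (hxy : x ≠ y) (Δ : ℕ) :
    (∃ k, 1 ≤ k ∧ ∃ (vs : ℕ → V') (ts : ℕ → ℕ),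
        TPath A' k vs ts ∧ Restless Δ k ts ∧ vs 0 = x ∧ vs k = y) ↔
    (∃ k, 1 ≤ k ∧ ∃ (vs : ℕ → V' ⊕ Unit) (ts : ℕ → ℕ),
        TPath (ReductionGraph A' x L') k vs ts ∧
        TimeConscious (fun _ t => min (t - 1) Δ) k vs ts ∧
        vs 0 = Sum.inl y ∧ vs k = Sum.inr ()) := by
  constructor
  · rintro ⟨k, hk, vs, ts, ⟨hw, hinj⟩, ⟨hmono, hrest⟩, h0, hlast⟩
    refine ⟨k + 1, by omega, fun i => if i ≤ k then Sum.inl (vs (k - i)) else Sum.inr (),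
      fun i => if i ≤ k then ts (k + 1 - i) else ts 1, ⟨?_, ?_⟩, ?_, ?_, ?_⟩
    · intro i hi hik
      by_cases h : i ≤ k
      · obtain ⟨ht, ha⟩ := hw (k + 1 - i) (by omega) (by omega)
        have e₁ : k + 1 - i - 1 = k - i := by omega
        have e₂ : k - (i - 1) = k + 1 - i := by omega
        have e₃ : i - 1 ≤ k := by omega
        rw [e₁] at ha
        simp only [h, e₃, if_true, e₂]
        exact ⟨ht, ha⟩
      · obtain rfl : i = k + 1 := by omega
        obtain ⟨ht, ha⟩ := hw 1 le_rfl hk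
        have hL := (hA' _ _ _ ha).2
        simp only [h, Nat.add_sub_cancel, le_refl, if_true, if_false, Nat.sub_self]
        exact ⟨ht, h0, ht, by omega⟩
    · intro i j hi hj hij
      by_cases h : i ≤ k <;> by_cases h' : j ≤ k <;> simp only [h, h', if_true, if_false] at hij
      · have := hinj _ _ (by omega) (by omega) (Sum.inl_injective hij)
        omega
      · cases hij
      · cases hij
      · omega
    · intro i hi hik
      have h : i ≤ k := by omega
      by_cases h' : i + 1 ≤ k
      · have h₁ := hmono (k - i) (by omega) (by omega)
        have h₂ := hrest (k - i) (by omega) (by omega)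
        have h₃ := (hw (k - i) (by omega) (by omega)).1
        have e₁ : k - i + 1 = k + 1 - i := by omega
        have e₂ : k + 1 - (i + 1) = k - i := by omega
        rw [e₁] at h₁ h₂
        simp only [h, h', if_true, e₂]
        omega
      · obtain rfl : i = k := by omega
        have h₃ := (hw 1 le_rfl hk).1
        have e : i + 1 - i = 1 := by omega
        simp only [h, h', if_true, if_false, e]
        omega
    · simp [hlast]
    · simp
  · rintro ⟨k, hk, vs, ts, ⟨hw, hinj⟩, hc, h0, hlast⟩
    have hinl : ∀ i, i < k → ∃ u, vs i = Sum.inl u := by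
      intro i hi
      cases h : vs i with
      | inl u => exact ⟨u, rfl⟩
      | inr u =>
        have := hinj i k hi.le le_rfl (by rw [h, hlast])
        omega
    have hx : vs (k - 1) = Sum.inl x := by
      obtain ⟨u, hu⟩ := hinl (k - 1) (by omega)
      have ha := (hw k hk le_rfl).2
      rw [hu, hlast] at ha
      rw [hu, ha.1]
    have hk1 : k ≠ 1 := by
      rintro rfl
      exact hxy (Sum.inl_injective (hx.symm.trans h0))
    have hf : ∀ i, ∃ u, i < k → vs i = Sum.inl u := by
      intro i
      by_cases h : i < k
      · obtain ⟨u, hu⟩ := hinl i h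
        exact ⟨u, fun _ => hu⟩
      · exact ⟨x, fun h' => absurd h' h⟩
    choose f hf using hf
    refine ⟨k - 1, by omega, fun i => f (k - 1 - i), fun i => ts (k - i),
      ⟨?_, ?_⟩, ⟨?_, ?_⟩, ?_, ?_⟩
    · intro i hi hik
      obtain ⟨ht, ha⟩ := hw (k - i) (by omega) (by omega)
      rw [hf _ (by omega), hf (k - i) (by omega)] at ha
      have e₁ : k - 1 - (i - 1) = k - i := by omega
      have e₂ : k - 1 - i = k - i - 1 := by omega
      simp only [e₁, e₂]
      exact ⟨ht, ha⟩
    · intro i j hi hj hij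
      have := hinj (k - 1 - i) (k - 1 - j) (by omega) (by omega)
        (by rw [hf _ (by omega), hf (k - 1 - j) (by omega)]; exact congrArg Sum.inl hij)
      omega
    · intro i hi hik
      have h := (hc (k - (i + 1)) (by omega) (by omega)).1
      have e : k - (i + 1) + 1 = k - i := by omega
      rwa [e] at h
    · intro i hi hik
      have h := (hc (k - (i + 1)) (by omega) (by omega)).2
      have e : k - (i + 1) + 1 = k - i := by omega
      rw [e] at h
      dsimp only at h ⊢
      omega
    · exact Sum.inl_injective (((hf _ (by omega)).symm.trans hx))
    · have e : k - 1 - (k - 1) = 0 := by omega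
      simp only [e]
      exact Sum.inl_injective ((hf 0 (by omega)).symm.trans h0)
end
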